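/- arXiv:2412.18520 — 3 statements merged into one kernel-verified Lean document; each statement's English description precedes it below -/
import Mathlib

section
/- Fix a rational number r > 1. For every periodic pair (c, n) with n ≥ 2, the map x ↦ f_{c,r}^{n−1}(x) is differentiable at x = c with nonzero derivative, the map g_n(t) = f_{t,r}^n(0) is differentiable at t = c with nonzero derivative, and consequently the quotient (d/dx f_{c,r}^{n−1}(x))|_{x=c} / g_n'(c) is a well-defined nonzero real number. -/
theorem Real.abs_rpow_ratCast_pow_den {s : ℚ} (hs : 0 ≤ s) (x : ℝ) :
    (|x| ^ (s : ℝ)) ^ s.den = |x| ^ s.num.toNat := by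
  have hnum : ((s.num.toNat : ℕ) : ℤ) = s.num := Int.toNat_of_nonneg (Rat.num_nonneg.mpr hs)
  have hmul : (s : ℝ) * (s.den : ℝ) = (s.num.toNat : ℝ) := by
    have h : s * (s.den : ℚ) = (s.num.toNat : ℚ) := by
      rw [Rat.mul_den_eq_num]
      exact_mod_cast hnum.symm
    exact_mod_cast h
  rw [← Real.rpow_natCast, ← Real.rpow_mul (abs_nonneg x), hmul, Real.rpow_natCast]

section Valuation

variable {Γ₀ : Type*} [LinearOrderedCommGroupWithZero Γ₀] (v : Valuation ℝ Γ₀)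

theorem Valuation.map_abs (x : ℝ) : v |x| = v x := by
  rcases abs_choice x with h | h <;> rw [h]
  exact v.map_neg x

theorem Valuation.map_abs_rpow_ratCast_pow_den {s : ℚ} (hs : 0 ≤ s) (x : ℝ) :
    v (|x| ^ (s : ℝ)) ^ s.den = v x ^ s.num.toNat := by
  rw [← map_pow, Real.abs_rpow_ratCast_pow_den hs, map_pow, v.map_abs]

theorem Valuation.map_abs_rpow_ratCast_le_one {s : ℚ} (hs : 0 ≤ s) {x : ℝ} (hx : v x ≤ 1) :
    v (|x| ^ (s : ℝ)) ≤ 1 := by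
  rw [← pow_le_one_iff_of_nonneg zero_le s.den_nz, v.map_abs_rpow_ratCast_pow_den hs]
  exact pow_le_one₀ zero_le hx

theorem Valuation.lt_map_abs_rpow_ratCast {s : ℚ} (hs : 1 < s) {x : ℝ} (hx : 1 < v x) :
    v x < v (|x| ^ (s : ℝ)) := by
  rw [← pow_lt_pow_iff_left₀ zero_le zero_le s.den_nz,
    v.map_abs_rpow_ratCast_pow_den (zero_le_one.trans hs.le)]
  apply pow_lt_pow_right₀ hx
  have : (s.den : ℤ) < s.num := by
    have h := Rat.lt_iff 1 s |>.mp hs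
    simpa using h
  omega

theorem Valuation.map_abs_rpow_sub_two_mul_le_one {r : ℚ} (hr : 1 < r) {x : ℝ} (hx : v x ≤ 1) :
    v (|x| ^ ((r : ℝ) - 2) * x) ≤ 1 := by
  rcases eq_or_ne x 0 with rfl | hx0
  · simp
  have h : |x| ^ ((r : ℝ) - 2) * |x| = |x| ^ ((r - 1 : ℚ) : ℝ) := by
    rw [← Real.rpow_add_one (abs_ne_zero.mpr hx0)]
    congr 1
    push_cast
    ring
  rw [map_mul, ← v.map_abs x, ← map_mul, h]
  exact v.map_abs_rpow_ratCast_le_one (sub_nonneg.mpr hr.le) hx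

/-- If the critical point is periodic under `x ↦ |x| ^ r + c`, then `c` is `v`-integral. -/
theorem Valuation.map_le_one_of_iterate_eq_zero {r : ℚ} (hr : 1 < r) {c : ℝ} {n : ℕ} (hn : n ≠ 0)
    (hper : (fun x : ℝ => |x| ^ (r : ℝ) + c)^[n] 0 = 0) : v c ≤ 1 := by
  by_contra! hc
  have key : ∀ k : ℕ, v c ≤ v ((fun x : ℝ => |x| ^ (r : ℝ) + c)^[k + 1] 0) := by
    intro k
    induction k with
    | zero =>
      have h0 : (r : ℝ) ≠ 0 := by exact_mod_cast (zero_lt_one.trans hr).ne'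
      simp [Real.zero_rpow h0]
    | succ k ih =>
      rw [Function.iterate_succ_apply']
      have h := ih.trans_lt (v.lt_map_abs_rpow_ratCast hr (hc.trans_le ih))
      rw [v.map_add_eq_of_lt_left h]
      exact h.le
  obtain ⟨m, rfl⟩ := Nat.exists_eq_succ_of_ne_zero hn
  have h := key m
  rw [← Nat.succ_eq_add_one, hper, map_zero] at h
  exact absurd (hc.trans_le h) (not_lt.mpr zero_le_one)

theorem Valuation.map_iterate_abs_rpow_add_le_one {r : ℚ} (hr : 0 ≤ r) {c : ℝ} (hc : v c ≤ 1)
    (k : ℕ) : v ((fun x : ℝ => |x| ^ (r : ℝ) + c)^[k] 0) ≤ 1 := by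
  induction k with
  | zero => simp
  | succ k ih =>
    rw [Function.iterate_succ_apply']
    exact v.map_add_le (v.map_abs_rpow_ratCast_le_one hr ih) hc

end Valuation

theorem exists_valuationSubring_valuation_prime_lt_one (K : Type*) [Field K] [CharZero K] {p : ℕ}
    (hp : p.Prime) : ∃ B : ValuationSubring K, B.valuation (p : K) < 1 := by
  let A : Subring K := (Int.castRingHom K).range
  let a : A := ⟨(p : K), (p : ℤ), by simp⟩
  have hI : Ideal.span {a} ≠ ⊤ := by
    rw [Ne, Ideal.span_singleton_eq_top, isUnit_iff_exists_inv]
    rintro ⟨⟨_, m, rfl⟩, h⟩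
    have h' : (p : K) * (m : K) = 1 := congrArg Subtype.val h
    have hInt : (p : ℤ) * m = 1 := by exact_mod_cast h'
    exact (Nat.prime_iff_prime_int.mp hp).not_isUnit (IsUnit.of_mul_eq_one _ hInt)
  obtain ⟨B, -, hB⟩ := Ideal.image_subset_nonunits_valuationSubring _ hI
  exact ⟨B, B.mem_nonunits_iff.mp (hB ⟨a, Ideal.mem_span_singleton_self a, rfl⟩)⟩

theorem ValuationSubring.valuation_intCast_le_one {K : Type*} [Field K] (B : ValuationSubring K)
    (m : ℤ) : B.valuation (m : K) ≤ 1 :=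
  (B.valuation_le_one_iff _).mpr (intCast_mem B m)

theorem exists_valuationSubring_valuation_ratCast_lt_one (K : Type*) [Field K] [CharZero K] {r : ℚ}
    (hr : 1 < r) : ∃ B : ValuationSubring K, B.valuation (r : K) < 1 := by
  have hden : (r.den : ℤ) < r.num := by simpa using Rat.lt_iff 1 r |>.mp hr
  have hden0 := r.den_pos
  obtain ⟨p, hp, hpr⟩ := Nat.exists_prime_and_dvd (n := r.num.natAbs) (by omega)
  obtain ⟨B, hB⟩ := exists_valuationSubring_valuation_prime_lt_one K hp
  refine ⟨B, ?_⟩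
  have hnum : B.valuation (r.num : K) < 1 := by
    obtain ⟨m, hm⟩ := Int.natCast_dvd.mpr hpr
    rw [hm]
    push_cast
    rw [map_mul]
    exact mul_lt_one_of_lt_of_le hB (B.valuation_intCast_le_one m)
  have hcop : IsCoprime r.num (r.den : ℤ) :=
    Int.isCoprime_iff_gcd_eq_one.mpr r.reduced
  obtain ⟨a, b, hab⟩ := hcop
  have hden1 : B.valuation (r.den : K) = 1 := by
    refine le_antisymm (by simp) ?_
    by_contra! hlt
    have h1 : (a : K) * (r.num : K) + (b : K) * (r.den : K) = 1 := by exact_mod_cast hab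
    have h2 := B.valuation.map_add_lt (x := (a : K) * (r.num : K)) (y := (b : K) * (r.den : K))
      (g := 1)
      (by rw [map_mul, mul_comm]; exact mul_lt_one_of_lt_of_le hnum (B.valuation_intCast_le_one a))
      (by rw [map_mul, mul_comm]; exact mul_lt_one_of_lt_of_le hlt (B.valuation_intCast_le_one b))
    rw [h1, map_one] at h2
    exact lt_irrefl _ h2
  rwa [Rat.cast_def, map_div₀, hden1, div_one]

theorem exists_hasDerivAt_iterate_abs_rpow_add_ne_zero {r : ℝ} (hr : 1 < r) (c x : ℝ) (k : ℕ)
    (hx : ∀ j < k, (fun y : ℝ => |y| ^ r + c)^[j] x ≠ 0) :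
    ∃ d : ℝ, d ≠ 0 ∧ HasDerivAt (fun x : ℝ => (fun y : ℝ => |y| ^ r + c)^[k] x) d x := by
  induction k with
  | zero => exact ⟨1, one_ne_zero, hasDerivAt_id x⟩
  | succ k ih =>
    obtain ⟨d, hd, hder⟩ := ih fun j hj => hx j (hj.trans k.lt_succ_self)
    have hk := hx k k.lt_succ_self
    simp only [Function.iterate_succ_apply']
    refine ⟨_, ?_, ((hasDerivAt_abs_rpow _ hr).comp x hder).add_const c⟩
    exact mul_ne_zero (mul_ne_zero (mul_ne_zero (by positivity)
      (Real.rpow_pos_of_pos (abs_pos.mpr hk) _).ne') hk) hd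

/-- The parameter derivative of the critical orbit is congruent to `1` modulo the maximal ideal. -/
theorem exists_hasDerivAt_param_iterate_abs_rpow_add {Γ₀ : Type*}
    [LinearOrderedCommGroupWithZero Γ₀] (v : Valuation ℝ Γ₀) {r : ℚ} (hr : 1 < r)
    (hvr : v (r : ℝ) < 1) {c : ℝ} (hc : v c ≤ 1) (k : ℕ) :
    ∃ d : ℝ, v (d - 1) < 1 ∧
      HasDerivAt (fun t : ℝ => (fun x : ℝ => |x| ^ (r : ℝ) + t)^[k + 1] 0) d c := by
  have hr' : (1 : ℝ) < r := by exact_mod_cast hr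
  induction k with
  | zero =>
    refine ⟨1, by simp, ?_⟩
    simpa using (hasDerivAt_id c).const_add (|(0 : ℝ)| ^ (r : ℝ))
  | succ k ih =>
    obtain ⟨d, hd, hder⟩ := ih
    simp only [Function.iterate_succ_apply' _ (k + 1)]
    refine ⟨_, ?_, ((hasDerivAt_abs_rpow _ hr').comp c hder).add (hasDerivAt_id c)⟩
    have hd1 : v d ≤ 1 := by
      have h := v.map_add_le hd.le v.map_one.le
      rwa [sub_add_cancel] at h
    rw [add_sub_cancel_right, mul_assoc (r : ℝ), map_mul, map_mul]
    refine mul_lt_one_of_lt_of_le (mul_lt_one_of_lt_of_le hvr ?_) hd1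
    exact v.map_abs_rpow_sub_two_mul_le_one hr
      (v.map_iterate_abs_rpow_add_le_one (zero_le_one.trans hr.le) hc (k + 1))

/-- For a fixed rational `r > 1` and a periodic pair `(c, n)` with `n ≥ 2`,
the map `x ↦ f_{c,r}^{n-1}(x)` is differentiable at `x = c` with nonzero derivative,
`g_n(t) = f_{t,r}^n(0)` is differentiable at `t = c` with nonzero derivative, and the
quotient of the two derivatives is a nonzero real number. -/
theorem stmt_1 (r : ℚ) (hr : 1 < r) (c : ℝ) (n : ℕ) (hn : 2 ≤ n)
    (hper : (fun x : ℝ => |x| ^ (r : ℝ) + c)^[n] 0 = 0)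
    (hprim : ∀ j : ℕ, 1 ≤ j → j ≤ n - 1 →
      (fun x : ℝ => |x| ^ (r : ℝ) + c)^[j] 0 ≠ 0) :
    DifferentiableAt ℝ (fun x : ℝ => (fun y : ℝ => |y| ^ (r : ℝ) + c)^[n - 1] x) c ∧
    deriv (fun x : ℝ => (fun y : ℝ => |y| ^ (r : ℝ) + c)^[n - 1] x) c ≠ 0 ∧
    DifferentiableAt ℝ (fun t : ℝ => (fun x : ℝ => |x| ^ (r : ℝ) + t)^[n] 0) c ∧
    deriv (fun t : ℝ => (fun x : ℝ => |x| ^ (r : ℝ) + t)^[n] 0) c ≠ 0 ∧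
    deriv (fun x : ℝ => (fun y : ℝ => |y| ^ (r : ℝ) + c)^[n - 1] x) c /
      deriv (fun t : ℝ => (fun x : ℝ => |x| ^ (r : ℝ) + t)^[n] 0) c ≠ 0 := by
  have hr' : (1 : ℝ) < r := by exact_mod_cast hr
  have hfirst : |(0 : ℝ)| ^ (r : ℝ) + c = c := by
    simp [Real.zero_rpow (zero_lt_one.trans hr').ne']
  obtain ⟨d, hd, hder⟩ := exists_hasDerivAt_iterate_abs_rpow_add_ne_zero hr' c c (n - 1) (by
    intro j hj
    have h := hprim (j + 1) (by omega) (by omega)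
    rwa [Function.iterate_succ_apply, hfirst] at h)
  obtain ⟨B, hB⟩ := exists_valuationSubring_valuation_ratCast_lt_one ℝ hr
  have hc := B.valuation.map_le_one_of_iterate_eq_zero hr (by omega) hper
  obtain ⟨e, he, heder⟩ :=
    exists_hasDerivAt_param_iterate_abs_rpow_add B.valuation hr hB hc (n - 1)
  rw [Nat.sub_add_cancel (by omega)] at heder
  have he0 : e ≠ 0 := by
    rintro rfl
    simp [Valuation.map_neg] at he
  rw [hder.deriv, heder.deriv]
  exact ⟨hder.differentiableAt, hd, heder.differentiableAt, he0, div_ne_zero hd he0⟩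
end

section
/- Fix a rational number r > 1. For every periodic pair (c, n) — i.e., f_{c,r}^n(0) = 0 and f_{c,r}^j(0) ≠ 0 for all j ∈ [1, n−1] — the parameter c is an algebraic integer. -/
/-- An element of a field that lies in every valuation subring is integral over `ℤ`. -/
theorem isIntegral_int_of_forall_mem_valuationSubring {K : Type*} [Field K] {x : K}
    (h : ∀ V : ValuationSubring K, x ∈ V) : IsIntegral ℤ x := by
  have : IsIntegrallyClosedIn (integralClosure ℤ K).toSubring K :=
    inferInstanceAs (IsIntegrallyClosedIn (integralClosure ℤ K) K)
  by_contra hx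
  obtain ⟨V, -, hV⟩ := Subring.exists_le_valuationSubring_of_isIntegrallyClosedIn
    (R := (integralClosure ℤ K).toSubring) (x := x) hx
  exact hV (h V)

theorem Valuation.map_abs_s3 {R Γ : Type*} [Ring R] [LinearOrder R]
    [LinearOrderedCommMonoidWithZero Γ] (v : Valuation R Γ) (x : R) : v |x| = v x := by
  rcases abs_choice x with h | h <;> simp [h, Valuation.map_neg]

/-- A rational power with exponent larger than one strictly increases every valuation that is
already larger than one. -/
theorem Valuation.lt_map_abs_rpow {Γ : Type*} [LinearOrderedCommGroupWithZero Γ]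
    (v : Valuation ℝ Γ) {r : ℚ} (hr : 1 < r) {x : ℝ} (hx : 1 < v x) :
    v x < v (|x| ^ (r : ℝ)) := by
  have hnum : (r.den : ℤ) < r.num := by
    have hden : (0 : ℚ) < r.den := by exact_mod_cast r.den_pos
    have h := Rat.num_div_den r
    rw [← h, one_lt_div hden] at hr
    exact_mod_cast hr
  obtain ⟨p, hp⟩ := Int.eq_ofNat_of_zero_le (r.den.cast_nonneg.trans hnum.le)
  have hlt : r.den < p := by omega
  have hmul : (r : ℝ) * r.den = p := by
    have h : r * r.den = p := by rw [Rat.mul_den_eq_num, hp]; simp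
    exact_mod_cast h
  have hpow : (|x| ^ (r : ℝ)) ^ r.den = |x| ^ p := by
    rw [← Real.rpow_mul_natCast (abs_nonneg x), hmul, Real.rpow_natCast]
  refine lt_of_pow_lt_pow_left₀ r.den zero_le ?_
  rw [← map_pow v (|x| ^ (r : ℝ)), hpow, map_pow, v.map_abs_s3]
  exact pow_lt_pow_right₀ hx hlt

/-- If `c` has valuation larger than one, then the valuation of the critical orbit of
`x ↦ |x| ^ r + c` never drops below that of `c`. -/
theorem Valuation.le_map_iterate_abs_rpow_add {Γ : Type*} [LinearOrderedCommGroupWithZero Γ]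
    (v : Valuation ℝ Γ) {r : ℚ} (hr : 1 < r) {c : ℝ} (hc : 1 < v c) (n : ℕ) :
    v c ≤ v ((fun x : ℝ => |x| ^ (r : ℝ) + c)^[n + 1] 0) := by
  induction n with
  | zero =>
    have hr0 : (r : ℝ) ≠ 0 := by exact_mod_cast (zero_lt_one.trans hr).ne'
    simp [Real.zero_rpow hr0]
  | succ n ih =>
    rw [Function.iterate_succ_apply']
    have h := ih.trans_lt (v.lt_map_abs_rpow hr (hc.trans_le ih))
    rw [v.map_add_eq_of_lt_left h]
    exact h.le

/-- For a fixed rational `r > 1`, for every periodic pair `(c, n)` for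
`f_{c,r}(x) = |x|^r + c`, the parameter `c` is an algebraic integer. -/
theorem stmt_3 (r : ℚ) (hr : 1 < r) (c : ℝ) (n : ℕ) (hn : 1 ≤ n)
    (hper : (fun x : ℝ => |x| ^ (r : ℝ) + c)^[n] 0 = 0)
    (hprim : ∀ j : ℕ, 1 ≤ j → j ≤ n - 1 →
      (fun x : ℝ => |x| ^ (r : ℝ) + c)^[j] 0 ≠ 0) :
    IsIntegral ℤ c := by
  refine isIntegral_int_of_forall_mem_valuationSubring fun V => ?_
  rw [← V.valuation_le_one_iff]
  by_contra! hc
  obtain ⟨m, rfl⟩ := Nat.exists_eq_add_of_le' hn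
  have h := V.valuation.le_map_iterate_abs_rpow_add hr hc m
  rw [hper, map_zero] at h
  exact absurd (hc.trans_le h) (not_lt.mpr zero_le)
end

section
/- Let r = p/q with p > q ≥ 1 coprime positive integers, and let c ∈ ℝ be an algebraic integer such that f_{c,r}^j(0) ≠ 0 for all j with 1 ≤ j ≤ n−1 (for some n ≥ 1). Then for every j with 1 ≤ j ≤ n, the function g_j(t) = f_{t,r}^j(0) is differentiable at t = c and the real number q^{j−1} · g_j'(c) is an algebraic integer. -/
theorem IsIntegral.abs {x : ℝ} (hx : IsIntegral ℤ x) : IsIntegral ℤ |x| := by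
  rcases abs_choice x with h | h <;> rw [h]
  exacts [hx, hx.neg]

theorem IsIntegral.rpow_natCast_div {x : ℝ} (hx : IsIntegral ℤ x) (hx0 : 0 ≤ x) (m : ℕ) {q : ℕ}
    (hq : 0 < q) : IsIntegral ℤ (x ^ ((m : ℝ) / (q : ℝ))) := by
  refine IsIntegral.of_pow hq ?_
  rw [← Real.rpow_mul_natCast hx0, div_mul_cancel₀ _ (by positivity), Real.rpow_natCast]
  exact hx.pow m

theorem isIntegral_signType_cast (s : SignType) : IsIntegral ℤ (s : ℝ) := by
  cases s
  exacts [by simpa using isIntegral_zero, by simpa using isIntegral_one.neg,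
    by simpa using isIntegral_one]

theorem isIntegral_iterate_abs_rpow_add (p : ℕ) {q : ℕ} (hq : 0 < q) {c : ℝ}
    (hc : IsIntegral ℤ c) (j : ℕ) :
    IsIntegral ℤ ((fun x : ℝ => |x| ^ ((p : ℝ) / (q : ℝ)) + c)^[j] 0) := by
  induction j with
  | zero => exact isIntegral_zero
  | succ j ih =>
    rw [Function.iterate_succ_apply']
    exact (ih.abs.rpow_natCast_div (abs_nonneg _) p hq).add hc

theorem HasDerivAt.abs_rpow_add_id {g : ℝ → ℝ} {D c : ℝ} (hg : HasDerivAt g D c) (h0 : g c ≠ 0)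
    (r : ℝ) :
    HasDerivAt (fun t => |g t| ^ r + t)
      (SignType.sign (g c) * D * r * |g c| ^ (r - 1) + 1) c :=
  (((hasDerivAt_abs h0).comp c hg).rpow_const (Or.inl (abs_ne_zero.mpr h0))).add (hasDerivAt_id c)


/-- Let `r = p/q` with `p > q ≥ 1` coprime positive integers, and let `c`
be an algebraic integer with `f_{c,r}^j(0) ≠ 0` for all `1 ≤ j ≤ n - 1`. Then for each
`1 ≤ j ≤ n`, `g_j(t) = f_{t,r}^j(0)` is differentiable at `c` and `q^(j-1) * g_j'(c)`
is an algebraic integer. -/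
theorem stmt_4 (p q : ℕ) (hq : 1 ≤ q) (hpq : q < p) (hcop : Nat.Coprime p q)
    (c : ℝ) (hc : IsIntegral ℤ c) (n : ℕ) (hn : 1 ≤ n)
    (hprim : ∀ j : ℕ, 1 ≤ j → j ≤ n - 1 →
      (fun x : ℝ => |x| ^ ((p : ℝ) / (q : ℝ)) + c)^[j] 0 ≠ 0) :
    ∀ j : ℕ, 1 ≤ j → j ≤ n →
      DifferentiableAt ℝ
        (fun t : ℝ => (fun x : ℝ => |x| ^ ((p : ℝ) / (q : ℝ)) + t)^[j] 0) c ∧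
      IsIntegral ℤ ((q : ℝ) ^ (j - 1) *
        deriv (fun t : ℝ => (fun x : ℝ => |x| ^ ((p : ℝ) / (q : ℝ)) + t)^[j] 0) c) := by
  have hq0 : (q : ℝ) ≠ 0 := by positivity
  suffices H : ∀ j : ℕ, 1 ≤ j → j ≤ n → ∃ D : ℝ,
      HasDerivAt (fun t : ℝ => (fun x : ℝ => |x| ^ ((p : ℝ) / (q : ℝ)) + t)^[j] 0) D c ∧
        IsIntegral ℤ ((q : ℝ) ^ (j - 1) * D) by
    intro j hj hjn
    obtain ⟨D, hD, hint⟩ := H j hj hjn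
    exact ⟨hD.differentiableAt, hD.deriv ▸ hint⟩
  intro j hj
  induction j, hj using Nat.le_induction with
  | base =>
    intro _
    have hr : (p : ℝ) / (q : ℝ) ≠ 0 := div_ne_zero (by norm_cast; omega) hq0
    refine ⟨1, ?_, by simpa using isIntegral_one⟩
    simpa [Real.zero_rpow hr] using hasDerivAt_id' c
  | succ j hj ih =>
    intro hjn
    obtain ⟨D, hD, hint⟩ := ih (by omega)
    have hD' := hD.abs_rpow_add_id (hprim j hj (by omega)) ((p : ℝ) / (q : ℝ))
    refine ⟨_, by simpa only [Function.iterate_succ_apply'] using hD', ?_⟩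
    have hx := isIntegral_iterate_abs_rpow_add p hq hc j
    set x := (fun x : ℝ => |x| ^ ((p : ℝ) / (q : ℝ)) + c)^[j] 0
    have hexp : (p : ℝ) / q - 1 = ((p - q : ℕ) : ℝ) / q := by
      rw [Nat.cast_sub hpq.le, sub_div, div_self hq0]
    have hpow : (q : ℝ) ^ (j + 1 - 1) = q ^ (j - 1) * q := by
      rw [← pow_succ]; congr 1; omega
    have hnat (m : ℕ) : IsIntegral ℤ (m : ℝ) := by
      simpa using isIntegral_algebraMap (R := ℤ) (A := ℝ) (x := (m : ℤ))
    have key : (q : ℝ) ^ (j + 1 - 1) *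
        (SignType.sign x * D * ((p : ℝ) / q) * |x| ^ ((p : ℝ) / q - 1) + 1) =
        SignType.sign x * p * |x| ^ (((p - q : ℕ) : ℝ) / q) * (q ^ (j - 1) * D)
          + q ^ (j - 1) * q := by
      rw [hexp, hpow]
      field_simp
    rw [key]
    exact ((((isIntegral_signType_cast _).mul (hnat p)).mul
      (hx.abs.rpow_natCast_div (abs_nonneg _) _ hq)).mul hint).add
      (((hnat q).pow _).mul (hnat q))
end
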